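/- Let J be a finite index set, let d ≥ 2, and let r = (r_j)_{j∈J} be nonnegative radii. If τ₁ and τ₂ are NNI-adjacent binary hierarchies over J, then the portal Portal(τ₁, τ₂) := int S(τ₁) ∩ int S(τ₂) is nonempty, where int denotes topological interior in (ℝᵈ)^J; in other words, every edge of the NNI-graph is also an edge of the adjacency graph of strata. -/

import Mathlib

open Finset

/-- A binary hierarchy over a finite index set `J`, encoded by its cluster set:
a laminar family of nonempty subsets of `J` containing the root `J` and all
singletons, in which every nonsingleton member is the disjoint union of exactly
two members (its children). -/
structure BinaryHierarchy (J : Type*) [DecidableEq J] [Fintype J] where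
  clusters : Finset (Finset J)
  root_mem : (Finset.univ : Finset J) ∈ clusters
  singleton_mem : ∀ j : J, ({j} : Finset J) ∈ clusters
  nonempty_of_mem : ∀ I ∈ clusters, I.Nonempty
  laminar : ∀ I ∈ clusters, ∀ K ∈ clusters, I ⊆ K ∨ K ⊆ I ∨ Disjoint I K
  binary_split : ∀ I ∈ clusters, 1 < I.card →
    ∃ L ∈ clusters, ∃ R ∈ clusters, Disjoint L R ∧ L ∪ R = I

variable {J : Type*} [DecidableEq J] [Fintype J]

/-- The parent of a cluster `I`: the smallest member of the (laminar) family strictly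
containing `I`, realized as the intersection of all members strictly containing `I`
(these form a chain in a laminar family). -/
def BinaryHierarchy.parent (τ : BinaryHierarchy J) (I : Finset J) : Finset J :=
  (τ.clusters.filter fun K => I ⊂ K).inf id

/-- The sibling (local complement) of a cluster `I`. -/
def BinaryHierarchy.sibling (τ : BinaryHierarchy J) (I : Finset J) : Finset J :=
  τ.parent I \ I

/-- A nearest neighbor interchange move from `τ` to `τ'`: there is a cluster `A ∈ C(τ)`
whose parent `P = Pr(A,τ)` is not the root, with `B := P \ A` and `C := Pr(P,τ) \ P`,
such that `C(τ') = (C(τ) \ {A ∪ B}) ∪ {B ∪ C}`. -/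
def NNIMove (τ τ' : BinaryHierarchy J) : Prop :=
  ∃ A ∈ τ.clusters, τ.parent A ≠ Finset.univ ∧
    τ'.clusters =
      (τ.clusters \ {A ∪ (τ.parent A \ A)}) ∪
        {(τ.parent A \ A) ∪ (τ.parent (τ.parent A) \ τ.parent A)}

/-- Two binary hierarchies are NNI-adjacent if one is obtained from the other by a
single nearest neighbor interchange. -/
def NNIAdjacent (τ τ' : BinaryHierarchy J) : Prop := NNIMove τ τ' ∨ NNIMove τ' τ

open scoped RealInnerProductSpace

/-- Centroid of the partial configuration `x|A`. -/
noncomputable def centroid {E : Type*} [NormedAddCommGroup E] [NormedSpace ℝ E]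
    (x : J → E) (A : Finset J) : E :=
  (A.card : ℝ)⁻¹ • ∑ a ∈ A, x a

/-- The configuration space of labelled, noncolliding disks with radii `r` in `ℝ^d`. -/
def Conf (d : ℕ) (J : Type*) (r : J → ℝ) : Set (J → EuclideanSpace ℝ (Fin d)) :=
  {x | ∀ i j : J, i ≠ j → r i + r j < ‖x i - x j‖}

/-- `s_I(x)`: difference of the centroids of the cluster `I` and its sibling. -/
noncomputable def sepVec (τ : BinaryHierarchy J) {d : ℕ}
    (x : J → EuclideanSpace ℝ (Fin d)) (I : Finset J) : EuclideanSpace ℝ (Fin d) :=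
  centroid x I - centroid x (τ.sibling I)

/-- `m_I(x)`: midpoint of the centroids of the cluster `I` and its sibling. -/
noncomputable def midpt (τ : BinaryHierarchy J) {d : ℕ}
    (x : J → EuclideanSpace ℝ (Fin d)) (I : Finset J) : EuclideanSpace ℝ (Fin d) :=
  (2 : ℝ)⁻¹ • (centroid x I + centroid x (τ.sibling I))

/-- `σ_{i,I,τ}(x)`: signed distance of agent `i` to the separating hyperplane of `I`
and its sibling. -/
noncomputable def separation (τ : BinaryHierarchy J) {d : ℕ}
    (x : J → EuclideanSpace ℝ (Fin d)) (I : Finset J) (i : J) : ℝ :=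
  ⟪x i - midpt τ x I, ‖sepVec τ x I‖⁻¹ • sepVec τ x I⟫

/-- The stratum of configurations supporting the binary hierarchy `τ`. -/
def stratum (d : ℕ) (r : J → ℝ) (τ : BinaryHierarchy J) :
    Set (J → EuclideanSpace ℝ (Fin d)) :=
  {x | x ∈ Conf d J r ∧ ∀ I ∈ τ.clusters, I ≠ Finset.univ →
      sepVec τ x I ≠ 0 ∧ ∀ i ∈ I, 0 ≤ separation τ x I i}

/-- `I` and `K` are the two children of a cluster of `τ`. -/
def BinaryHierarchy.AreSiblings (τ : BinaryHierarchy J) (I K : Finset J) : Prop :=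
  I ∈ τ.clusters ∧ K ∈ τ.clusters ∧ Disjoint I K ∧ I ∪ K ∈ τ.clusters

namespace BinaryHierarchy

variable {τ : BinaryHierarchy J} {I K L R M : Finset J}

theorem AreSiblings.symm (h : τ.AreSiblings I K) : τ.AreSiblings K I :=
  ⟨h.2.1, h.1, h.2.2.1.symm, by rw [union_comm]; exact h.2.2.2⟩

theorem AreSiblings.subset_or_subset (h : τ.AreSiblings L R) (hM : M ∈ τ.clusters)
    (hs : M ⊂ L ∪ R) : M ⊆ L ∨ M ⊆ R := by
  have hd := h.2.2.1
  have hM0 := τ.nonempty_of_mem M hM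
  have hL0 := τ.nonempty_of_mem L h.1
  have hR0 := τ.nonempty_of_mem R h.2.1
  rcases τ.laminar M hM L h.1 with h1 | h1 | h1
  · exact .inl h1
  · rcases τ.laminar M hM R h.2.1 with h2 | h2 | h2
    · exact .inr h2
    · exact absurd (union_subset h1 h2) hs.2
    · left
      intro j hj
      rcases mem_union.1 (hs.1 hj) with h3 | h3
      · exact h3
      · exact absurd h3 (disjoint_left.1 h2 hj)
  · right
    intro j hj
    rcases mem_union.1 (hs.1 hj) with h3 | h3
    · exact absurd h3 (disjoint_left.1 h1 hj)
    · exact h3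

theorem AreSiblings.subset_or_disjoint
    (h : τ.AreSiblings L R) (hM : M ∈ τ.clusters) (hne : M ≠ L ∪ R)
    (hc : M.card ≤ (L ∪ R).card) : M ⊆ L ∨ M ⊆ R ∨ Disjoint M (L ∪ R) := by
  rcases τ.laminar M hM _ h.2.2.2 with h1 | h1 | h1
  · rw [← or_assoc]
    exact .inl (h.subset_or_subset hM (h1.ssubset_of_ne hne))
  · exact absurd (eq_of_subset_of_card_le h1 hc).symm hne
  · exact .inr (.inr h1)

theorem AreSiblings.ssubset_union (h : τ.AreSiblings I K) : I ⊂ I ∪ K := by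
  refine ⟨subset_union_left, fun hs => ?_⟩
  obtain ⟨k, hk⟩ := τ.nonempty_of_mem K h.2.1
  exact disjoint_left.1 h.2.2.1 (hs (mem_union_right _ hk)) hk

theorem AreSiblings.sdiff_left (h : τ.AreSiblings I K) : (I ∪ K) \ I = K := by
  rw [union_sdiff_left, sdiff_eq_self_of_disjoint h.2.2.1.symm]

theorem AreSiblings.unique (h : τ.AreSiblings I K) (h' : τ.AreSiblings L R)
    (he : I ∪ K = L ∪ R) : (I = L ∧ K = R) ∨ (I = R ∧ K = L) := by
  have key : ∀ L R : Finset J, τ.AreSiblings L R → I ∪ K = L ∪ R → I ⊆ L →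
      I = L ∧ K = R := by
    intro L R h' he hIL
    have hLI : L ⊆ I ∨ L ⊆ K := h.subset_or_subset h'.1 (he ▸ h'.ssubset_union)
    have hLI : L ⊆ I := by
      rcases hLI with h1 | h1
      · exact h1
      · obtain ⟨i, hi⟩ := τ.nonempty_of_mem I h.1
        exact absurd (h1 (hIL hi)) (disjoint_left.1 h.2.2.1 hi)
    obtain rfl := hIL.antisymm hLI
    exact ⟨rfl, by rw [← h.sdiff_left, he, h'.sdiff_left]⟩
  rcases h'.subset_or_subset h.1 (he ▸ h.ssubset_union) with h1 | h1
  · exact .inl (key L R h' he h1)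
  · exact .inr (key R L h'.symm (by rw [he, union_comm]) h1)

theorem AreSiblings.parent_eq (h : τ.AreSiblings I K) : τ.parent I = I ∪ K := by
  apply le_antisymm
  · exact Finset.inf_le (f := id) (mem_filter.2 ⟨h.2.2.2, h.ssubset_union⟩)
  · refine Finset.le_inf fun M hM => ?_
    obtain ⟨hM, hIM⟩ := mem_filter.1 hM
    show I ∪ K ⊆ M
    have hI0 := τ.nonempty_of_mem I h.1
    rcases τ.laminar M hM _ h.2.2.2 with h1 | h1 | h1
    · by_cases h2 : M = I ∪ K
      · exact h2.ge
      · rcases h.subset_or_subset hM (h1.ssubset_of_ne h2) with h3 | h3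
        · exact absurd h3 hIM.2
        · obtain ⟨i, hi⟩ := hI0
          exact absurd (h3 (hIM.1 hi)) (disjoint_left.1 h.2.2.1 hi)
    · exact h1
    · obtain ⟨i, hi⟩ := hI0
      exact absurd (mem_union_left _ hi) (disjoint_left.1 h1 (hIM.1 hi))

theorem AreSiblings.sibling_eq (h : τ.AreSiblings I K) : τ.sibling I = K := by
  rw [sibling, h.parent_eq, h.sdiff_left]

theorem exists_areSiblings_of_one_lt_card (hM : M ∈ τ.clusters) (hc : 1 < M.card) :
    ∃ L R, τ.AreSiblings L R ∧ L ∪ R = M := by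
  obtain ⟨L, hL, R, hR, hd, he⟩ := τ.binary_split M hM hc
  exact ⟨L, R, ⟨hL, hR, hd, by rwa [he]⟩, he⟩

theorem exists_areSiblings_of_ne_univ (hI : I ∈ τ.clusters) (hu : I ≠ univ) :
    ∃ K, τ.AreSiblings I K := by
  obtain ⟨M, hM, hmin⟩ := exists_min_image (τ.clusters.filter fun K => I ⊂ K) card
    ⟨univ, mem_filter.2 ⟨τ.root_mem, (subset_univ I).ssubset_of_ne hu⟩⟩
  obtain ⟨hM, hIM⟩ := mem_filter.1 hM
  have hI0 := τ.nonempty_of_mem I hI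
  obtain ⟨L, R, hLR, rfl⟩ := exists_areSiblings_of_one_lt_card hM
    (lt_of_le_of_lt hI0.card_pos (card_lt_card hIM))
  have eq_of_subset : ∀ N ∈ τ.clusters, N ⊂ L ∪ R → I ⊆ N → I = N := by
    intro N hN hNM hIN
    by_contra hne
    have := hmin N (mem_filter.2 ⟨hN, hIN.ssubset_of_ne hne⟩)
    exact absurd (card_lt_card hNM) this.not_gt
  rcases hLR.subset_or_subset hI hIM with h | h
  · obtain rfl := eq_of_subset L hLR.1 hLR.ssubset_union h
    exact ⟨R, hLR⟩
  · obtain rfl := eq_of_subset R hLR.2.1 (union_comm R L ▸ hLR.symm.ssubset_union) h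
    exact ⟨L, hLR.symm⟩

theorem exists_areSiblings_separating (τ : BinaryHierarchy J) {i j : J} (hij : i ≠ j) :
    ∃ I K, τ.AreSiblings I K ∧ i ∈ I ∧ j ∈ K := by
  obtain ⟨M, hM, hmin⟩ := exists_min_image (τ.clusters.filter fun K => i ∈ K ∧ j ∈ K) card
    ⟨univ, mem_filter.2 ⟨τ.root_mem, mem_univ i, mem_univ j⟩⟩
  obtain ⟨hM, hi, hj⟩ := mem_filter.1 hM
  obtain ⟨L, R, hLR, rfl⟩ := exists_areSiblings_of_one_lt_card hM
    (one_lt_card.2 ⟨i, hi, j, hj, hij⟩)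
  have not_both : ∀ N ∈ τ.clusters, N ⊂ L ∪ R → i ∈ N → j ∉ N := fun N hN hNM hiN hjN =>
    absurd (card_lt_card hNM) (hmin N (mem_filter.2 ⟨hN, hiN, hjN⟩)).not_gt
  have hL := not_both L hLR.1 hLR.ssubset_union
  have hR := not_both R hLR.2.1 (union_comm R L ▸ hLR.symm.ssubset_union)
  rcases mem_union.1 hi with hi | hi <;> rcases mem_union.1 hj with hj | hj
  · exact absurd hj (hL hi)
  · exact ⟨L, R, hLR, hi, hj⟩
  · exact ⟨R, L, hLR.symm, hi, hj⟩
  · exact absurd hj (hR hi)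

end BinaryHierarchy

/-- Every point of `t` indexed by `I` is strictly closer to the centroid of `I` than to the
centroid of `K`. -/
def CloserToOwn {ι : Type*} (t : ι → ℝ) (I K : Finset ι) : Prop :=
  ∀ i ∈ I, (t i - _root_.centroid t I) ^ 2 < (t i - _root_.centroid t K) ^ 2

theorem centroid_add_mul {ι : Type*} (p q : ι → ℝ) (ε : ℝ) (I : Finset ι) :
    _root_.centroid (fun j => p j + ε * q j) I
      = _root_.centroid p I + ε * _root_.centroid q I := by
  simp only [_root_.centroid, sum_add_distrib, ← mul_sum, smul_eq_mul]
  ring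

theorem centroid_of_const {ι : Type*} {p : ι → ℝ} {I : Finset ι} {u : ℝ} (hI : I.Nonempty)
    (h : ∀ j ∈ I, p j = u) : _root_.centroid p I = u := by
  have : (I.card : ℝ) ≠ 0 := by exact_mod_cast hI.card_pos.ne'
  rw [_root_.centroid, sum_congr rfl h, sum_const, nsmul_eq_mul, smul_eq_mul]
  field_simp

theorem CloserToOwn.eventually_add_mul {ι : Type*} {p : ι → ℝ} {I K : Finset ι}
    (h : CloserToOwn p I K) (q : ι → ℝ) :
    ∀ᶠ ε in nhds (0 : ℝ), CloserToOwn (fun j => p j + ε * q j) I K := by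
  simp only [CloserToOwn, centroid_add_mul]
  rw [Filter.eventually_all_finset]
  intro i hi
  refine ContinuousAt.eventually_lt (by fun_prop) (by fun_prop) ?_
  simpa using h i hi

theorem CloserToOwn.add_mul_of_const {ι : Type*} {p q : ι → ℝ} {I K : Finset ι}
    (hI : I.Nonempty) (hK : K.Nonempty) {u : ℝ} (hpI : ∀ j ∈ I, p j = u) (hpK : ∀ j ∈ K, p j = u)
    (h : CloserToOwn q I K) {ε : ℝ} (hε : 0 < ε) :
    CloserToOwn (fun j => p j + ε * q j) I K := by
  intro i hi
  simp only [centroid_add_mul, centroid_of_const hI hpI, centroid_of_const hK hpK, hpI i hi]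
  have := mul_lt_mul_of_pos_left (h i hi) (pow_pos hε 2)
  linear_combination this

theorem closerToOwn_of_const {ι : Type*} {p : ι → ℝ} {I K : Finset ι} {u v : ℝ}
    (hI : I.Nonempty) (hK : K.Nonempty) (hpI : ∀ j ∈ I, p j = u) (hpK : ∀ j ∈ K, p j = v)
    (huv : u ≠ v) :
    CloserToOwn p I K := by
  intro i hi
  rw [centroid_of_const hI hpI, centroid_of_const hK hpK, hpI i hi]
  have := sub_ne_zero.2 huv
  rw [sub_self, zero_pow two_ne_zero]
  positivity

theorem exists_centroid_union {ι : Type*} [DecidableEq ι] {p : ι → ℝ} {A B : Finset ι} {s : ℝ}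
    (hA : A.Nonempty) (hB : B.Nonempty) (hAB : Disjoint A B) (hpA : ∀ j ∈ A, p j = -s)
    (hpB : ∀ j ∈ B, p j = 0) :
    ∃ θ : ℝ, 0 < θ ∧ θ < 1 ∧ _root_.centroid p (A ∪ B) = -s * θ := by
  have ha : (0 : ℝ) < A.card := by exact_mod_cast hA.card_pos
  have hb : (0 : ℝ) < B.card := by exact_mod_cast hB.card_pos
  refine ⟨A.card / (A.card + B.card), by positivity, ?_, ?_⟩
  · rw [div_lt_one (by positivity)]
    linarith
  · rw [_root_.centroid, card_union_of_disjoint hAB, sum_union hAB, sum_congr rfl hpA,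
      sum_congr rfl hpB]
    simp
    ring

/-- Three clusters placed at equally spaced collinear points `-s`, `0`, `s`. -/
theorem closerToOwn_union {ι : Type*} [DecidableEq ι] {p : ι → ℝ} {A B C : Finset ι} {s : ℝ}
    (hs : s ≠ 0) (hA : A.Nonempty) (hB : B.Nonempty) (hC : C.Nonempty)
    (hAB : Disjoint A B) (hpA : ∀ j ∈ A, p j = -s) (hpB : ∀ j ∈ B, p j = 0)
    (hpC : ∀ j ∈ C, p j = s) :
    CloserToOwn p (A ∪ B) C ∧ CloserToOwn p C (A ∪ B) := by
  obtain ⟨θ, h0, h1, hθ⟩ := exists_centroid_union hA hB hAB hpA hpB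
  have hs2 : 0 < s ^ 2 := by positivity
  constructor
  · intro i hi
    rw [hθ, centroid_of_const hC hpC]
    rcases mem_union.1 hi with hi | hi
    · rw [hpA i hi]
      have : 0 < s ^ 2 * (4 - (1 - θ) ^ 2) := mul_pos hs2 (by nlinarith)
      linear_combination this
    · rw [hpB i hi]
      have : 0 < s ^ 2 * (1 - θ ^ 2) := mul_pos hs2 (by nlinarith)
      linear_combination this
  · intro i hi
    rw [hθ, centroid_of_const hC hpC, hpC i hi]
    have : 0 < s ^ 2 * (1 + θ) ^ 2 := by positivity
    linear_combination this

/-- A finite family of clusters, each carrying a profile that solves the constraints attached to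
this cluster and is constant on all the other clusters that are not larger, admits a
simultaneous solution of all constraints. -/
theorem exists_closerToOwn (s : Finset (Finset J))
    (cst : Finset J → Finset J → Finset J → Prop)
    (hcst : ∀ G ∈ s, ∀ I K, cst G I K → I.Nonempty ∧ K.Nonempty ∧ I ⊆ G ∧ K ⊆ G)
    (hp : ∀ G ∈ s, ∃ p : J → ℝ, (∀ I K, cst G I K → CloserToOwn p I K) ∧
      ∀ G' ∈ s, G' ≠ G → G'.card ≤ G.card → ∃ u, ∀ j ∈ G', p j = u) :
    ∃ t : J → ℝ, ∀ G ∈ s, ∀ I K, cst G I K → CloserToOwn t I K := by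
  induction s using Finset.induction_on_max_value (card : Finset J → ℕ) with
  | empty => exact ⟨0, by simp⟩
  | insert G s hG hmax ih =>
    obtain ⟨q, hq⟩ := ih (fun G' h => hcst G' (mem_insert_of_mem h)) fun G' h => by
      obtain ⟨p, h1, h2⟩ := hp G' (mem_insert_of_mem h)
      exact ⟨p, h1, fun G'' h'' => h2 G'' (mem_insert_of_mem h'')⟩
    obtain ⟨p, h1, h2⟩ := hp G (mem_insert_self _ _)
    have hev : ∀ᶠ ε in nhds (0 : ℝ), ∀ I K, cst G I K →
        CloserToOwn (fun j => p j + ε * q j) I K := by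
      simp only [Filter.eventually_all]
      exact fun I K h => (h1 I K h).eventually_add_mul q
    obtain ⟨ε, hε, hε0⟩ := ((hev.filter_mono nhdsWithin_le_nhds).and
      (self_mem_nhdsWithin : Set.Ioi (0 : ℝ) ∈ nhdsWithin 0 (Set.Ioi 0))).exists
    refine ⟨fun j => p j + ε * q j, fun G' hG' I K hIK => ?_⟩
    rcases mem_insert.1 hG' with rfl | hG''
    · exact hε I K hIK
    · obtain ⟨hI, hK, hIG, hKG⟩ := hcst G' hG' I K hIK
      obtain ⟨u, hu⟩ := h2 G' hG' (fun h => hG (h ▸ hG'')) (hmax G' hG'')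
      exact (hq G' hG'' I K hIK).add_mul_of_const hI hK (fun j hj => hu j (hIG hj))
        (fun j hj => hu j (hKG hj)) hε0

/-- A line configuration realizing both sides of a nearest neighbor interchange. -/
theorem NNIMove.exists_closerToOwn {τ₁ τ₂ : BinaryHierarchy J} (h : NNIMove τ₁ τ₂) :
    ∃ t : J → ℝ, (∀ I K, τ₁.AreSiblings I K → CloserToOwn t I K) ∧
      ∀ I K, τ₂.AreSiblings I K → CloserToOwn t I K := by
  obtain ⟨A, hA, hP, hC₂⟩ := h
  have hAu : A ≠ univ := by
    rintro rfl
    refine hP ?_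
    have : (τ₁.clusters.filter fun K => univ ⊂ K) = ∅ :=
      filter_eq_empty_iff.2 fun K _ hK => hK.2 (subset_univ K)
    rw [BinaryHierarchy.parent, this, inf_empty, top_eq_univ]
  obtain ⟨B, hAB⟩ := BinaryHierarchy.exists_areSiblings_of_ne_univ hA hAu
  rw [hAB.parent_eq] at hP hC₂
  obtain ⟨C, hPC⟩ := BinaryHierarchy.exists_areSiblings_of_ne_univ hAB.2.2.2 hP
  rw [hPC.parent_eq, hPC.sdiff_left, hAB.sdiff_left] at hC₂
  have hmem : ∀ M, M ∈ τ₂.clusters ↔ (M ∈ τ₁.clusters ∧ M ≠ A ∪ B) ∨ M = B ∪ C := by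
    intro M
    rw [hC₂, mem_union, mem_sdiff, mem_singleton, mem_singleton]
  have hA0 := τ₁.nonempty_of_mem A hA
  have hB0 := τ₁.nonempty_of_mem B hAB.2.1
  have hC0 := τ₁.nonempty_of_mem C hPC.2.1
  have dAB := hAB.2.2.1
  obtain ⟨dAC, dBC⟩ := disjoint_union_left.1 hPC.2.2.1
  have hPQ : A ∪ B ≠ B ∪ C := by
    intro he
    obtain ⟨a, ha⟩ := hA0
    rcases mem_union.1 (he ▸ mem_union_left B ha) with h | h
    · exact disjoint_left.1 dAB ha h
    · exact disjoint_left.1 dAC ha h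
  have hP₂ : A ∪ B ∉ τ₂.clusters := by
    rw [hmem]
    simp [hPQ]
  have hA₂ : A ∈ τ₂.clusters := (hmem A).2 (.inl ⟨hA, hAB.ssubset_union.ne⟩)
  have hB₂ : B ∈ τ₂.clusters :=
    (hmem B).2 (.inl ⟨hAB.2.1, (union_comm B A ▸ hAB.symm.ssubset_union).ne⟩)
  have hC₂' : C ∈ τ₂.clusters := by
    refine (hmem C).2 (.inl ⟨hPC.2.1, ?_⟩)
    rintro rfl
    obtain ⟨a, ha⟩ := hA0
    exact disjoint_left.1 dAC ha (mem_union_left _ ha)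
  have hQ₂ : B ∪ C ∈ τ₂.clusters := (hmem _).2 (.inr rfl)
  have hG₂ : A ∪ B ∪ C ∈ τ₂.clusters :=
    (hmem _).2 (.inl ⟨hPC.2.2.2, hPC.ssubset_union.ne'⟩)
  have hBC : τ₂.AreSiblings B C := ⟨hB₂, hC₂', dBC, hQ₂⟩
  have hAQ : τ₂.AreSiblings A (B ∪ C) :=
    ⟨hA₂, hQ₂, disjoint_union_right.2 ⟨dAB, dAC⟩, by rwa [← union_assoc]⟩
  have hQ₁ : B ∪ C ∉ τ₁.clusters := by
    intro hQ
    obtain ⟨a, ha⟩ := hA0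
    obtain ⟨b, hb⟩ := hB0
    obtain ⟨c, hc⟩ := hC0
    rcases τ₁.laminar _ hQ _ hAB.2.2.2 with h | h | h
    · rcases mem_union.1 (h (mem_union_right _ hc)) with h' | h'
      · exact disjoint_left.1 dAC h' hc
      · exact disjoint_left.1 dBC h' hc
    · rcases mem_union.1 (h (mem_union_left _ ha)) with h' | h'
      · exact disjoint_left.1 dAB ha h'
      · exact disjoint_left.1 dAC ha h'
    · exact disjoint_left.1 h (mem_union_left _ hb) (mem_union_right _ hb)
  refine (_root_.exists_closerToOwn (τ₁.clusters.erase (A ∪ B))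
    (fun G I K => (τ₁.AreSiblings I K ∨ τ₂.AreSiblings I K) ∧
      (I ∪ K = G ∨ (G = A ∪ B ∪ C ∧ (I ∪ K = A ∪ B ∨ I ∪ K = B ∪ C)))) ?_ ?_).imp
    fun t ht => ⟨fun I K hIK => ?_, fun I K hIK => ?_⟩
  · rintro G - I K ⟨hs, hu⟩
    have hIK : I.Nonempty ∧ K.Nonempty := by
      rcases hs with hs | hs
      · exact ⟨τ₁.nonempty_of_mem I hs.1, τ₁.nonempty_of_mem K hs.2.1⟩
      · exact ⟨τ₂.nonempty_of_mem I hs.1, τ₂.nonempty_of_mem K hs.2.1⟩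
    refine ⟨hIK.1, hIK.2, union_subset_iff.1 ?_⟩
    rcases hu with rfl | ⟨rfl, hu | hu⟩
    · exact subset_rfl
    · rw [hu]; exact subset_union_left
    · rw [hu, union_assoc]; exact subset_union_right
  · intro G hG
    obtain ⟨hGP, hG⟩ := mem_erase.1 hG
    by_cases hGG : G = A ∪ B ∪ C
    · subst hGG
      have hpA : ∀ j ∈ A, (if j ∈ A then -1 else if j ∈ C then 1 else 0 : ℝ) = -1 :=
        fun j hj => if_pos hj
      have hpB : ∀ j ∈ B, (if j ∈ A then -1 else if j ∈ C then 1 else 0 : ℝ) = 0 :=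
        fun j hj => by rw [if_neg (disjoint_right.1 dAB hj), if_neg (disjoint_left.1 dBC hj)]
      have hpC : ∀ j ∈ C, (if j ∈ A then -1 else if j ∈ C then 1 else 0 : ℝ) = 1 :=
        fun j hj => by rw [if_neg (disjoint_right.1 dAC hj), if_pos hj]
      have hp0 : ∀ j ∉ A ∪ B ∪ C, (if j ∈ A then -1 else if j ∈ C then 1 else 0 : ℝ) = 0 := by
        intro j hj
        simp only [mem_union, not_or] at hj
        rw [if_neg hj.1.1, if_neg hj.2]
      refine ⟨fun j => if j ∈ A then -1 else if j ∈ C then 1 else 0, ?_, ?_⟩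
      · have s1 := closerToOwn_union one_ne_zero hA0 hB0 hC0 dAB hpA hpB hpC
        have s2 := closerToOwn_union (s := -1) (by norm_num) hC0 hB0 hA0 dBC.symm
          (by simpa using hpC) hpB hpA
        rw [union_comm C B] at s2
        rintro I K ⟨hs | hs, hu | ⟨-, hu | hu⟩⟩
        · rcases hs.unique hPC hu with ⟨rfl, rfl⟩ | ⟨rfl, rfl⟩
          · exact s1.1
          · exact s1.2
        · rcases hs.unique hAB hu with ⟨rfl, rfl⟩ | ⟨rfl, rfl⟩
          · exact closerToOwn_of_const hA0 hB0 hpA hpB (by norm_num)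
          · exact closerToOwn_of_const hB0 hA0 hpB hpA (by norm_num)
        · exact absurd (hu ▸ hs.2.2.2) hQ₁
        · rcases hs.unique hAQ (by rw [hu, union_assoc]) with ⟨rfl, rfl⟩ | ⟨rfl, rfl⟩
          · exact s2.2
          · exact s2.1
        · exact absurd (hu ▸ hs.2.2.2) hP₂
        · rcases hs.unique hBC hu with ⟨rfl, rfl⟩ | ⟨rfl, rfl⟩
          · exact closerToOwn_of_const hB0 hC0 hpB hpC (by norm_num)
          · exact closerToOwn_of_const hC0 hB0 hpC hpB (by norm_num)
      · intro M hM hne hc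
        obtain ⟨hMP, hM⟩ := mem_erase.1 hM
        rcases hPC.subset_or_disjoint hM hne hc with h | h | h
        · rcases hAB.subset_or_subset hM (h.ssubset_of_ne hMP) with h | h
          · exact ⟨-1, fun j hj => hpA j (h hj)⟩
          · exact ⟨0, fun j hj => hpB j (h hj)⟩
        · exact ⟨1, fun j hj => hpC j (h hj)⟩
        · exact ⟨0, fun j hj => hp0 j (disjoint_left.1 h hj)⟩
    · by_cases hcard : 1 < G.card
      · obtain ⟨L, R, hLR, rfl⟩ := BinaryHierarchy.exists_areSiblings_of_one_lt_card hG hcard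
        have hL0 := τ₁.nonempty_of_mem L hLR.1
        have hR0 := τ₁.nonempty_of_mem R hLR.2.1
        have hLP : L ≠ A ∪ B := by
          rintro rfl
          exact hGG (by rw [← hLR.parent_eq, hPC.parent_eq])
        have hRP : R ≠ A ∪ B := by
          rintro rfl
          exact hGG (by rw [union_comm, ← hLR.symm.parent_eq, hPC.parent_eq])
        have hLR₂ : τ₂.AreSiblings L R := ⟨(hmem _).2 (.inl ⟨hLR.1, hLP⟩),
          (hmem _).2 (.inl ⟨hLR.2.1, hRP⟩), hLR.2.2.1, (hmem _).2 (.inl ⟨hG, hGP⟩)⟩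
        have hpL : ∀ j ∈ L, (if j ∈ L then -1 else if j ∈ R then 1 else 0 : ℝ) = -1 :=
          fun j hj => if_pos hj
        have hpR : ∀ j ∈ R, (if j ∈ L then -1 else if j ∈ R then 1 else 0 : ℝ) = 1 :=
          fun j hj => by rw [if_neg (disjoint_right.1 hLR.2.2.1 hj), if_pos hj]
        have hp0 : ∀ j ∉ L ∪ R, (if j ∈ L then -1 else if j ∈ R then 1 else 0 : ℝ) = 0 := by
          intro j hj
          simp only [mem_union, not_or] at hj
          rw [if_neg hj.1, if_neg hj.2]
        refine ⟨fun j => if j ∈ L then -1 else if j ∈ R then 1 else 0, ?_, ?_⟩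
        · rintro I K ⟨hs, hu | ⟨hu, -⟩⟩
          · have : (I = L ∧ K = R) ∨ (I = R ∧ K = L) := by
              rcases hs with hs | hs
              · exact hs.unique hLR hu
              · exact hs.unique hLR₂ hu
            rcases this with ⟨rfl, rfl⟩ | ⟨rfl, rfl⟩
            · exact closerToOwn_of_const hL0 hR0 hpL hpR (by norm_num)
            · exact closerToOwn_of_const hR0 hL0 hpR hpL (by norm_num)
          · exact absurd hu hGG
        · intro M hM hne hc
          rcases hLR.subset_or_disjoint (mem_erase.1 hM).2 hne hc with h | h | h
          · exact ⟨-1, fun j hj => hpL j (h hj)⟩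
          · exact ⟨1, fun j hj => hpR j (h hj)⟩
          · exact ⟨0, fun j hj => hp0 j (disjoint_left.1 h hj)⟩
      · refine ⟨0, ?_, fun M _ _ _ => ⟨0, fun j _ => rfl⟩⟩
        rintro I K ⟨hs, hu | ⟨hu, -⟩⟩
        · refine absurd ?_ hcard
          subst hu
          have hI : I.Nonempty := by
            rcases hs with hs | hs
            · exact τ₁.nonempty_of_mem I hs.1
            · exact τ₂.nonempty_of_mem I hs.1
          have hlt : I ⊂ I ∪ K := by
            rcases hs with hs | hs <;> exact hs.ssubset_union
          exact lt_of_le_of_lt hI.card_pos (card_lt_card hlt)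
        · exact absurd hu hGG
  · by_cases he : I ∪ K = A ∪ B
    · exact ht (A ∪ B ∪ C) (mem_erase.2 ⟨hPC.ssubset_union.ne', hPC.2.2.2⟩) I K
        ⟨.inl hIK, .inr ⟨rfl, .inl he⟩⟩
    · exact ht (I ∪ K) (mem_erase.2 ⟨he, hIK.2.2.2⟩) I K ⟨.inl hIK, .inl rfl⟩
  · rcases (hmem _).1 hIK.2.2.2 with he | he
    · exact ht (I ∪ K) (mem_erase.2 he.symm) I K ⟨.inr hIK, .inl rfl⟩
    · exact ht (A ∪ B ∪ C) (mem_erase.2 ⟨hPC.ssubset_union.ne', hPC.2.2.2⟩) I K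
        ⟨.inr hIK, .inr ⟨rfl, .inr he⟩⟩

/-- The strict, division-free form of the conditions defining the stratum. -/
def strictStratum (d : ℕ) (r : J → ℝ) (τ : BinaryHierarchy J) :
    Set (J → EuclideanSpace ℝ (Fin d)) :=
  {x | x ∈ Conf d J r ∧ ∀ I ∈ τ.clusters, I ≠ Finset.univ →
      ∀ i ∈ I, 0 < ⟪x i - midpt τ x I, sepVec τ x I⟫}

theorem strictStratum_subset_interior (d : ℕ) (r : J → ℝ) (τ : BinaryHierarchy J) :
    strictStratum d r τ ⊆ interior (stratum d r τ) := by
  apply interior_maximal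
  · rintro x ⟨hx, h⟩
    refine ⟨hx, fun I hI hu => ⟨fun h0 => ?_, fun i hi => ?_⟩⟩
    · obtain ⟨i, hi⟩ := τ.nonempty_of_mem I hI
      have := h I hI hu i hi
      rw [h0, inner_zero_right] at this
      exact lt_irrefl _ this
    · rw [separation, inner_smul_right]
      exact mul_nonneg (inv_nonneg.2 (norm_nonneg _)) (h I hI hu i hi).le
  · simp only [strictStratum, Conf, Set.ofPred_and, Set.ofPred_forall]
    refine IsOpen.inter ?_ ?_
    · exact isOpen_iInter_of_finite fun i => isOpen_iInter_of_finite fun j =>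
        isOpen_iInter_of_finite fun _ => isOpen_lt (by fun_prop) (by fun_prop)
    · refine isOpen_iInter_of_finite fun I => isOpen_iInter_of_finite fun _ =>
        isOpen_iInter_of_finite fun _ => isOpen_iInter_of_finite fun i =>
        isOpen_iInter_of_finite fun _ => isOpen_lt (by fun_prop) ?_
      unfold midpt sepVec _root_.centroid
      fun_prop

theorem centroid_smul_const {ι : Type*} {d : ℕ} (t : ι → ℝ) (M : ℝ)
    (e : EuclideanSpace ℝ (Fin d)) (A : Finset ι) :
    _root_.centroid (fun j => (M * t j) • e) A = (M * _root_.centroid t A) • e := by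
  simp only [_root_.centroid, ← sum_smul, ← mul_sum, smul_smul, smul_eq_mul]
  congr 1
  ring

theorem smul_const_mem_strictStratum {d : ℕ} {r : J → ℝ} {τ : BinaryHierarchy J} {t : J → ℝ}
    (ht : ∀ I K, τ.AreSiblings I K → CloserToOwn t I K) {M : ℝ} (hM : 0 < M)
    {e : EuclideanSpace ℝ (Fin d)} (he : ‖e‖ = 1)
    (hr : ∀ i j, i ≠ j → r i + r j < M * |t i - t j|) :
    (fun j => (M * t j) • e) ∈ strictStratum d r τ := by
  refine ⟨fun i j hij => ?_, fun I hI hu i hi => ?_⟩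
  · rw [← sub_smul, ← mul_sub, norm_smul, he, mul_one, Real.norm_eq_abs, abs_mul,
      abs_of_pos hM]
    exact hr i j hij
  · obtain ⟨K, hK⟩ := BinaryHierarchy.exists_areSiblings_of_ne_univ hI hu
    have h := mul_lt_mul_of_pos_left (ht I K hK i hi) (pow_pos hM 2)
    rw [midpt, sepVec, hK.sibling_eq, centroid_smul_const, centroid_smul_const, ← add_smul,
      smul_smul, ← sub_smul, ← sub_smul, real_inner_smul_left, real_inner_smul_right,
      real_inner_self_eq_norm_sq, he]
    linear_combination (1 / 2) * h

theorem exists_pos_scale {ι : Type*} [Finite ι] {t : ι → ℝ} (ht : Function.Injective t)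
    (r : ι → ℝ) :
    ∃ M : ℝ, 0 < M ∧ ∀ i j, i ≠ j → r i + r j < M * |t i - t j| := by
  have hev : ∀ᶠ M : ℝ in Filter.atTop, ∀ i j, i ≠ j → r i + r j < M * |t i - t j| := by
    simp only [Filter.eventually_all]
    intro i j hij
    exact (Filter.tendsto_id.atTop_mul_const
      (abs_pos.2 (sub_ne_zero.2 (ht.ne hij)))).eventually_gt_atTop _
  exact ((Filter.eventually_gt_atTop 0).and hev).exists

theorem NNIMove.portal_nonempty {d : ℕ} (hd : 0 < d) (r : J → ℝ) {τ₁ τ₂ : BinaryHierarchy J}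
    (h : NNIMove τ₁ τ₂) :
    (interior (stratum d r τ₁) ∩ interior (stratum d r τ₂)).Nonempty := by
  obtain ⟨t, h₁, h₂⟩ := h.exists_closerToOwn
  have hinj : Function.Injective t := by
    intro i j hij
    by_contra hne
    obtain ⟨I, K, hIK, hi, hj⟩ := τ₁.exists_areSiblings_separating hne
    have hi := h₁ I K hIK i hi
    have hj := h₁ K I hIK.symm j hj
    rw [hij] at hi
    exact lt_asymm hi hj
  obtain ⟨M, hM, hr⟩ := exists_pos_scale hinj r
  have he : ‖(EuclideanSpace.single ⟨0, hd⟩ 1 : EuclideanSpace ℝ (Fin d))‖ = 1 := by simp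
  exact ⟨_, strictStratum_subset_interior d r τ₁ (smul_const_mem_strictStratum h₁ hM he hr),
    strictStratum_subset_interior d r τ₂ (smul_const_mem_strictStratum h₂ hM he hr)⟩

/-- every NNI edge is realized geometrically: the portal
`int S(τ₁) ∩ int S(τ₂)` of NNI-adjacent hierarchies is nonempty. -/
theorem portal_nonempty (d : ℕ) (hd : 2 ≤ d) (r : J → ℝ) (hr : ∀ j, 0 ≤ r j)
    (τ₁ τ₂ : BinaryHierarchy J) (hadj : NNIAdjacent τ₁ τ₂) :
    (interior (stratum d r τ₁) ∩ interior (stratum d r τ₂)).Nonempty := by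
  rcases hadj with h | h
  · exact h.portal_nonempty (by omega) r
  · rw [Set.inter_comm]
    exact h.portal_nonempty (by omega) r
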